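/- arXiv:1708.05079 — 3 statements merged into one kernel-verified Lean document; each statement's English description precedes it below -/
import Mathlib

section
/- Let d ≥ 1 and let T ⊆ ℝ^d be an open set with nonempty complement. Let 0 < q ≤ 2 and σ ∈ ℝ. Then there is a constant C, depending only on d, q and σ, such that for every measurable function Ψ on T one has ∫_T |Ψ(x)|^q d(x)^{q−1−qσ} dx ≤ C ‖Ψ‖_{L^{q,σ}_{av}(T)}^q. -/
open MeasureTheory Metric Set ENNReal

noncomputable section

/-- `wdist Ω x = dist(x, ℝ^d ∖ Ω)`. -/
def wdist {d : ℕ} (Ω : Set (EuclideanSpace ℝ (Fin d))) (x : EuclideanSpace ℝ (Fin d)) : ℝ :=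
  Metric.infDist x Ωᶜ

/-- The weighted averaged norm `‖H‖_{L^{q,σ}_{av}(Ω)}`. -/
def avNorm {d : ℕ} {F : Type*} [NormedAddCommGroup F] (q σ : ℝ)
    (Ω : Set (EuclideanSpace ℝ (Fin d))) (H : EuclideanSpace ℝ (Fin d) → F) : ℝ≥0∞ :=
  (∫⁻ x in Ω,
      ((volume (Metric.ball x (wdist Ω x / 2)))⁻¹ *
          ∫⁻ y in Metric.ball x (wdist Ω x / 2), (‖H y‖₊ : ℝ≥0∞) ^ (2 : ℕ)) ^ (q / 2) *
        ENNReal.ofReal (wdist Ω x) ^ (q - 1 - q * σ)) ^ (1 / q)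

/-- Jensen's inequality for averages over a set of positive finite measure. -/
theorem average_rpow_le_average_sq_rpow {α : Type*} [MeasurableSpace α] {μ : Measure α}
    {B : Set α} (hB0 : μ B ≠ 0) (hB : μ B ≠ ∞) {f : α → ℝ} (hf : Measurable f) {q : ℝ}
    (hq0 : 0 < q) (hq2 : q ≤ 2) :
    (μ B)⁻¹ * ∫⁻ y in B, (‖f y‖₊ : ℝ≥0∞) ^ q ∂μ ≤
      ((μ B)⁻¹ * ∫⁻ y in B, (‖f y‖₊ : ℝ≥0∞) ^ (2 : ℕ) ∂μ) ^ (q / 2) := by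
  have hν : IsProbabilityMeasure ((μ B)⁻¹ • μ.restrict B) :=
    ⟨by simp [ENNReal.inv_mul_cancel hB0 hB]⟩
  have h := eLpNorm'_le_eLpNorm'_of_exponent_le (μ := (μ B)⁻¹ • μ.restrict B) hq0 hq2
    hf.aestronglyMeasurable
  have h' := ENNReal.rpow_le_rpow h hq0.le
  simp only [eLpNorm', lintegral_smul_measure, smul_eq_mul, ← ENNReal.rpow_mul] at h'
  rw [one_div_mul_cancel hq0.ne', ENNReal.rpow_one, one_div_mul_eq_div] at h'
  simpa [enorm_eq_nnnorm] using h'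

/-- Powers of comparable positive numbers are comparable. -/
theorem min_rpow_mul_rpow_le {a b u v : ℝ} (s : ℝ) (ha : 0 < a) (hb : 0 < b) (hv : 0 < v)
    (h1 : a * v ≤ u) (h2 : u ≤ b * v) : min (a ^ s) (b ^ s) * v ^ s ≤ u ^ s := by
  have hu : 0 < u := (mul_pos ha hv).trans_le h1
  rcases le_total 0 s with hs | hs
  · calc min (a ^ s) (b ^ s) * v ^ s ≤ a ^ s * v ^ s := by gcongr; exact min_le_left _ _
      _ = (a * v) ^ s := (Real.mul_rpow ha.le hv.le).symm
      _ ≤ u ^ s := by gcongr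
  · calc min (a ^ s) (b ^ s) * v ^ s ≤ b ^ s * v ^ s := by gcongr; exact min_le_right _ _
      _ = (b * v) ^ s := (Real.mul_rpow hb.le hv.le).symm
      _ ≤ u ^ s := Real.rpow_le_rpow_of_nonpos hu h2 hs

section

variable {d : ℕ} {T : Set (EuclideanSpace ℝ (Fin d))}

theorem wdist_pos (hT : IsOpen T) (hTc : Tᶜ.Nonempty) {x : EuclideanSpace ℝ (Fin d)}
    (hx : x ∈ T) : 0 < wdist T x :=
  (hT.isClosed_compl.notMem_iff_infDist_pos hTc).1 (by simpa using hx)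

theorem mem_of_wdist_pos {x : EuclideanSpace ℝ (Fin d)} (hx : 0 < wdist T x) : x ∈ T := by
  by_contra h
  exact hx.ne' (infDist_zero_of_mem h)

theorem wdist_le_add_dist (x y : EuclideanSpace ℝ (Fin d)) :
    wdist T x ≤ wdist T y + dist x y :=
  infDist_le_infDist_add_dist

theorem measurable_wdist : Measurable (wdist T) :=
  (continuous_infDist_pt _).measurable

/-- The weight `d(x)^s / |B(x, d(x)/2)|`. -/
def ballWeight (T : Set (EuclideanSpace ℝ (Fin d))) (s : ℝ) (x : EuclideanSpace ℝ (Fin d)) :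
    ℝ≥0∞ :=
  (volume (ball x (wdist T x / 2)))⁻¹ * ENNReal.ofReal (wdist T x) ^ s

theorem measurable_ballWeight (s : ℝ) : Measurable (ballWeight T s) := by
  have h : ∀ x : EuclideanSpace ℝ (Fin d), volume (ball x (wdist T x / 2)) =
      volume (ball (0 : EuclideanSpace ℝ (Fin d)) (wdist T x / 2)) :=
    fun x => Measure.addHaar_ball_center _ _ _
  have hm : Monotone fun r : ℝ => volume (ball (0 : EuclideanSpace ℝ (Fin d)) r) :=
    fun _ _ h => measure_mono (ball_subset_ball h)
  have hd := measurable_wdist (T := T)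
  unfold ballWeight
  simp only [h]
  exact ((hm.measurable.comp (hd.div_const 2)).inv).mul (hd.ennreal_ofReal.pow_const s)

theorem mem_ball_half_wdist {x y : EuclideanSpace ℝ (Fin d)}
    (hx : x ∈ ball y (wdist T y / 4)) : y ∈ ball x (wdist T x / 2) := by
  rw [mem_ball] at hx ⊢
  have h := wdist_le_add_dist (T := T) y x
  rw [dist_comm] at hx
  have := dist_nonneg (x := y) (y := x)
  linarith

/-- The integral of the weight over `B(y, d(y)/4)` controls `d(y)^s`. -/
theorem rpow_wdist_le_lintegral_ballWeight (s : ℝ) {y : EuclideanSpace ℝ (Fin d)}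
    (hy : 0 < wdist T y) :
    ENNReal.ofReal (wdist T y) ^ s ≤
      ENNReal.ofReal ((5 / 2) ^ d * (min ((3 / 4 : ℝ) ^ s) ((5 / 4) ^ s))⁻¹) *
        ∫⁻ x in ball y (wdist T y / 4), ballWeight T s x := by
  set c : ℝ := min ((3 / 4 : ℝ) ^ s) ((5 / 4) ^ s)
  have hc0 : 0 < c := lt_min (by positivity) (by positivity)
  set δ := wdist T y
  set V := volume (ball y (δ / 4)) with hV
  have hV0 : V ≠ 0 := (measure_ball_pos _ _ (by positivity)).ne'
  have hVt : V ≠ ∞ := measure_ball_lt_top.ne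
  have hscale : ∀ x : EuclideanSpace ℝ (Fin d),
      volume (ball x (5 / 2 * (δ / 4))) = ENNReal.ofReal ((5 / 2) ^ d) * V := by
    intro x
    rw [Measure.addHaar_ball_mul_of_pos _ _ (by norm_num), hV, finrank_euclideanSpace_fin,
      Measure.addHaar_ball_center _ y]
  have hlow : ∀ x ∈ ball y (δ / 4),
      (ENNReal.ofReal ((5 / 2) ^ d) * V)⁻¹ * ENNReal.ofReal (c * δ ^ s) ≤ ballWeight T s x := by
    intro x hx
    rw [mem_ball] at hx
    have h1 := wdist_le_add_dist (T := T) x y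
    have h2 := wdist_le_add_dist (T := T) y x
    rw [dist_comm y x] at h2
    have hx0 : 0 < wdist T x := by linarith
    unfold ballWeight
    rw [ENNReal.ofReal_rpow_of_pos hx0]
    gcongr
    · rw [← hscale x]
      exact measure_mono (ball_subset_ball (by linarith))
    · exact min_rpow_mul_rpow_le s (by norm_num) (by norm_num) hy (by linarith) (by linarith)
  have hint : (ENNReal.ofReal ((5 / 2) ^ d) * V)⁻¹ * ENNReal.ofReal (c * δ ^ s) * V ≤
      ∫⁻ x in ball y (δ / 4), ballWeight T s x := by
    rw [hV, ← setLIntegral_const]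
    exact setLIntegral_mono' measurableSet_ball hlow
  refine le_trans (le_of_eq ?_) (mul_le_mul_right hint _)
  have hD0 : ENNReal.ofReal ((5 / 2) ^ d) ≠ 0 := by
    simp only [ne_eq, ENNReal.ofReal_eq_zero, not_le]; positivity
  have hD : ENNReal.ofReal ((5 / 2) ^ d) ≠ ∞ := ENNReal.ofReal_ne_top
  have hC0 : ENNReal.ofReal c ≠ 0 := by simpa using hc0
  rw [ENNReal.mul_inv (Or.inl hD0) (Or.inl hD), ENNReal.ofReal_mul (by positivity),
    ENNReal.ofReal_mul hc0.le, ENNReal.ofReal_inv_of_pos hc0, ENNReal.ofReal_rpow_of_pos hy]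
  set D := ENNReal.ofReal ((5 / 2) ^ d)
  set c' := ENNReal.ofReal c
  set w := ENNReal.ofReal (δ ^ s)
  calc w = (D * D⁻¹) * (c'⁻¹ * c') * (V⁻¹ * V) * w := by
        rw [ENNReal.mul_inv_cancel hD0 hD, ENNReal.inv_mul_cancel hC0 ENNReal.ofReal_ne_top,
          ENNReal.inv_mul_cancel hV0 hVt]
        simp
    _ = D * c'⁻¹ * (D⁻¹ * V⁻¹ * (c' * w) * V) := by ring

/-- The Fubini step: integrating `g` against `d^s` is controlled by integrating its averages. -/
theorem lintegral_mul_rpow_wdist_le (hT : IsOpen T) (hTc : Tᶜ.Nonempty) (s : ℝ)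
    {g : EuclideanSpace ℝ (Fin d) → ℝ≥0∞} (hg : Measurable g) :
    ∫⁻ y in T, g y * ENNReal.ofReal (wdist T y) ^ s ≤
      ENNReal.ofReal ((5 / 2) ^ d * (min ((3 / 4 : ℝ) ^ s) ((5 / 4) ^ s))⁻¹) *
        ∫⁻ x in T, ballWeight T s x * ∫⁻ y in ball x (wdist T x / 2), g y := by
  set C := ENNReal.ofReal ((5 / 2) ^ d * (min ((3 / 4 : ℝ) ^ s) ((5 / 4) ^ s))⁻¹)
  set S : Set (EuclideanSpace ℝ (Fin d) × EuclideanSpace ℝ (Fin d)) :=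
    {p | dist p.2 p.1 < wdist T p.1 / 2}
  have hSm : MeasurableSet S :=
    measurableSet_lt (measurable_snd.dist measurable_fst)
      ((measurable_wdist.comp measurable_fst).div_const 2)
  set G : EuclideanSpace ℝ (Fin d) → EuclideanSpace ℝ (Fin d) → ℝ≥0∞ :=
    fun x y => S.indicator (fun p => ballWeight T s p.1 * g p.2) (x, y) with hG
  have hGm : Measurable (Function.uncurry G) :=
    (((measurable_ballWeight s).comp measurable_fst).mul (hg.comp measurable_snd)).indicator hSm
  have hpt : ∀ y ∈ T, g y * ENNReal.ofReal (wdist T y) ^ s ≤ C * ∫⁻ x in T, G x y := by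
    intro y hy
    have hy0 := wdist_pos hT hTc hy
    have hsub : ball y (wdist T y / 4) ⊆ T := by
      intro x hx
      have h := mem_ball_half_wdist hx
      exact mem_of_wdist_pos (by linarith [dist_nonneg.trans_lt (mem_ball.1 h)])
    calc g y * ENNReal.ofReal (wdist T y) ^ s
        ≤ g y * (C * ∫⁻ x in ball y (wdist T y / 4), ballWeight T s x) := by
          gcongr
          exact rpow_wdist_le_lintegral_ballWeight s hy0
      _ = C * ∫⁻ x in ball y (wdist T y / 4), ballWeight T s x * g y := by
          rw [lintegral_mul_const _ (measurable_ballWeight s)]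
          ring
      _ = C * ∫⁻ x in ball y (wdist T y / 4), G x y := by
          congr 1
          refine setLIntegral_congr_fun measurableSet_ball fun x hx => ?_
          have hmem : (x, y) ∈ S := mem_ball_half_wdist hx
          simp only [hG, indicator_of_mem hmem]
      _ ≤ C * ∫⁻ x in T, G x y := by
          gcongr
  calc ∫⁻ y in T, g y * ENNReal.ofReal (wdist T y) ^ s
      ≤ ∫⁻ y in T, C * ∫⁻ x in T, G x y := setLIntegral_mono' hT.measurableSet hpt
    _ = C * ∫⁻ y in T, ∫⁻ x in T, G x y := lintegral_const_mul' _ _ ENNReal.ofReal_ne_top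
    _ = C * ∫⁻ x in T, ∫⁻ y in T, G x y := by
        rw [lintegral_lintegral_swap hGm.aemeasurable]
    _ ≤ C * ∫⁻ x in T, ballWeight T s x * ∫⁻ y in ball x (wdist T x / 2), g y := by
        gcongr with x
        rw [← lintegral_const_mul _ hg, ← lintegral_indicator measurableSet_ball]
        exact setLIntegral_le_lintegral _ _

end

theorem unaveraged_le_averaged (d : ℕ) (hd : 1 ≤ d) (q σ : ℝ) (hq0 : 0 < q) (hq2 : q ≤ 2) :
    ∃ C : ℝ, 0 < C ∧
      ∀ T : Set (EuclideanSpace ℝ (Fin d)), IsOpen T → Tᶜ.Nonempty →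
        ∀ Ψ : EuclideanSpace ℝ (Fin d) → ℝ, Measurable Ψ →
          (∫⁻ x in T, (‖Ψ x‖₊ : ℝ≥0∞) ^ q * ENNReal.ofReal (wdist T x) ^ (q - 1 - q * σ)) ≤
            ENNReal.ofReal C * (avNorm q σ T Ψ) ^ q := by
  set s : ℝ := q - 1 - q * σ
  refine ⟨(5 / 2) ^ d * (min ((3 / 4 : ℝ) ^ s) ((5 / 4) ^ s))⁻¹,
    mul_pos (by positivity) (inv_pos.2 (lt_min (by positivity) (by positivity))), ?_⟩
  intro T hT hTc Ψ hΨ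
  refine (lintegral_mul_rpow_wdist_le hT hTc s
    (hΨ.nnnorm.coe_nnreal_ennreal.pow_const q)).trans ?_
  rw [avNorm, ← ENNReal.rpow_mul, one_div_mul_cancel hq0.ne', ENNReal.rpow_one]
  refine mul_le_mul_right (setLIntegral_mono' hT.measurableSet fun x hx => ?_) _
  have hx0 := wdist_pos hT hTc hx
  rw [ballWeight, mul_right_comm]
  gcongr
  exact average_rpow_le_average_sq_rpow (measure_ball_pos _ _ (by positivity)).ne'
    measure_ball_lt_top.ne hΨ hq0 hq2
end
end

section
/- Let d ≥ 1, let Ω ⊆ ℝ^d be an open set with nonempty complement, let x_0 ∈ Ω and set δ = d(x_0) > 0. Let 0 < h < 1 and let E < −d be a real number. Then ∫_{Γ_h(x_0)} d(x)^E dx ≤ C h^E δ^{d+E}, where C depends only on d and E. -/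
open MeasureTheory Metric Set ENNReal

noncomputable section

/-- The nontangential cone `Γ_h(x₀) = {x ∈ Ω : |x₀ − x| < d(x)/h}`. -/
def cone {d : ℕ} (Ω : Set (EuclideanSpace ℝ (Fin d))) (h : ℝ) (x₀ : EuclideanSpace ℝ (Fin d)) :
    Set (EuclideanSpace ℝ (Fin d)) :=
  {x ∈ Ω | dist x₀ x < wdist Ω x / h}

/-- The weight is comparable from below to `h (δ + |x - x₀|)` on the cone. -/
theorem wdist_lower_bound_of_mem_cone {d : ℕ} {Ω : Set (EuclideanSpace ℝ (Fin d))} {h : ℝ}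
    (h0 : 0 < h) (h1 : h < 1) {x₀ x : EuclideanSpace ℝ (Fin d)} (hx : x ∈ cone Ω h x₀) :
    h / 3 * (wdist Ω x₀ + dist x₀ x) ≤ wdist Ω x := by
  have hlt : dist x₀ x * h < wdist Ω x := (lt_div_iff₀ h0).1 hx.2
  have htri : wdist Ω x₀ ≤ wdist Ω x + dist x₀ x := infDist_le_infDist_add_dist
  have hnonneg : 0 ≤ wdist Ω x := infDist_nonneg
  nlinarith

/-- Change of variables for the affine map `x ↦ δ⁻¹ (x - x₀)`. -/
theorem lintegral_comp_inv_smul_sub {d : ℕ} {f : EuclideanSpace ℝ (Fin d) → ℝ≥0∞}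
    (hf : Measurable f) {δ : ℝ} (hδ : 0 < δ) (x₀ : EuclideanSpace ℝ (Fin d)) :
    ∫⁻ x, f (δ⁻¹ • (x - x₀)) = ENNReal.ofReal (δ ^ d) * ∫⁻ x, f x := by
  rw [lintegral_sub_right_eq_self (fun x => f (δ⁻¹ • x)) x₀,
    ← lintegral_map hf (measurable_const_smul δ⁻¹),
    Measure.map_addHaar_smul volume (inv_ne_zero hδ.ne'), lintegral_smul_measure, smul_eq_mul,
    finrank_euclideanSpace_fin, inv_pow, inv_inv, abs_of_pos (pow_pos hδ d)]

theorem cone_weight_integral (d : ℕ) (hd : 1 ≤ d) (E : ℝ) (hE : E < -(d : ℝ)) :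
    ∃ C : ℝ, 0 < C ∧
      ∀ Ω : Set (EuclideanSpace ℝ (Fin d)), IsOpen Ω → Ωᶜ.Nonempty →
      ∀ x₀ ∈ Ω, ∀ h : ℝ, 0 < h → h < 1 →
        (∫⁻ x in cone Ω h x₀, ENNReal.ofReal (wdist Ω x ^ E)) ≤
          ENNReal.ofReal C * ENNReal.ofReal (h ^ E) *
            ENNReal.ofReal (wdist Ω x₀ ^ ((d : ℝ) + E)) := by
  set g : EuclideanSpace ℝ (Fin d) → ℝ≥0∞ := fun x => ENNReal.ofReal ((1 + ‖x‖) ^ E) with hg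
  have hgm : Measurable g := by fun_prop
  have hfin : ∫⁻ x, g x < ∞ := by
    have := finite_integral_one_add_norm (E := EuclideanSpace ℝ (Fin d)) (μ := volume) (r := -E)
      (by rw [finrank_euclideanSpace_fin]; linarith)
    simpa only [neg_neg] using this
  set I : ℝ := (∫⁻ x, g x).toReal with hI
  have hI0 : 0 ≤ I := ENNReal.toReal_nonneg
  have hE0 : E ≤ 0 := by linarith [Nat.cast_nonneg (α := ℝ) d]
  refine ⟨(3⁻¹ : ℝ) ^ E * (I + 1), by positivity, fun Ω hΩ hΩc x₀ hx₀ h h0 h1 => ?_⟩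
  set δ := wdist Ω x₀ with hδdef
  have hδ : 0 < δ :=
    (hΩ.isClosed_compl.notMem_iff_infDist_pos hΩc).1 fun hmem => hmem hx₀
  have hpt : ∀ x ∈ cone Ω h x₀, ENNReal.ofReal (wdist Ω x ^ E) ≤
      ENNReal.ofReal ((h / 3 * δ) ^ E) * g (δ⁻¹ • (x - x₀)) := by
    intro x hx
    rw [hg, ← ENNReal.ofReal_mul (by positivity), ← Real.mul_rpow (by positivity) (by positivity)]
    refine ENNReal.ofReal_le_ofReal (Real.rpow_le_rpow_of_nonpos (by positivity) ?_ hE0)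
    refine le_of_eq_of_le ?_ (wdist_lower_bound_of_mem_cone h0 h1 hx)
    rw [norm_smul, norm_inv, Real.norm_of_nonneg hδ.le, dist_comm, dist_eq_norm, ← hδdef]
    field_simp
  calc ∫⁻ x in cone Ω h x₀, ENNReal.ofReal (wdist Ω x ^ E)
      ≤ ∫⁻ x in cone Ω h x₀, ENNReal.ofReal ((h / 3 * δ) ^ E) * g (δ⁻¹ • (x - x₀)) :=
        setLIntegral_mono (by fun_prop) hpt
    _ ≤ ∫⁻ x, ENNReal.ofReal ((h / 3 * δ) ^ E) * g (δ⁻¹ • (x - x₀)) := setLIntegral_le_lintegral _ _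
    _ = ENNReal.ofReal ((h / 3 * δ) ^ E) * (ENNReal.ofReal (δ ^ d) * ENNReal.ofReal I) := by
        rw [lintegral_const_mul _ (by fun_prop), lintegral_comp_inv_smul_sub hgm hδ,
          ENNReal.ofReal_toReal hfin.ne]
    _ ≤ _ := by
        rw [← ENNReal.ofReal_mul (by positivity), ← ENNReal.ofReal_mul (by positivity),
          ← ENNReal.ofReal_mul (by positivity), ← ENNReal.ofReal_mul (by positivity)]
        refine ENNReal.ofReal_le_ofReal ?_
        rw [div_eq_mul_inv, Real.mul_rpow (by positivity) hδ.le,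
          Real.mul_rpow h0.le (by positivity), Real.rpow_add hδ, Real.rpow_natCast]
        calc h ^ E * 3⁻¹ ^ E * δ ^ E * (δ ^ d * I)
            = 3⁻¹ ^ E * I * h ^ E * (δ ^ d * δ ^ E) := by ring
          _ ≤ 3⁻¹ ^ E * (I + 1) * h ^ E * (δ ^ d * δ ^ E) := by gcongr; linarith
end
end

section
/- Let 1 ≤ q < ∞ and σ > 0. Then there is a constant C, depending only on q and σ, such that for all real numbers a < b, every μ ∈ [a,b], and every measurable function g : (a,b) → [0,∞]: ∫_a^b ( ∫ between μ and r of g(s) ds )^q dr ≤ C (b−a)^{1+qσ} ∫_a^b g(s)^q (s−a)^{q−1−qσ} ds, where for each r the inner integral is taken over the interval with endpoints μ and r. -/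
open MeasureTheory Set ENNReal

noncomputable section

theorem lintegral_Ioo_ofReal_sub_rpow {a b β : ℝ} (hab : a < b) (hβ : 0 < β) :
    ∫⁻ s in Ioo a b, ENNReal.ofReal ((s - a) ^ (β - 1)) =
      ENNReal.ofReal ((b - a) ^ β / β) := by
  have hint : IntervalIntegrable (fun s : ℝ => (s - a) ^ (β - 1)) volume a b := by
    have h := (intervalIntegral.intervalIntegrable_rpow' (a := 0) (b := b - a)
      (r := β - 1) (by linarith)).comp_sub_right a
    simpa using h
  have hval : ∫ s in a..b, (s - a) ^ (β - 1) = (b - a) ^ β / β := by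
    rw [intervalIntegral.integral_comp_sub_right (fun x : ℝ => x ^ (β - 1)) a,
      integral_rpow (Or.inl (by linarith))]
    simp [Real.zero_rpow hβ.ne']
  rw [← hval, intervalIntegral.integral_of_le hab.le, integral_Ioc_eq_integral_Ioo,
    ofReal_integral_eq_lintegral_ofReal]
  · exact (((intervalIntegrable_iff_integrableOn_Ioc_of_le hab.le).1 hint).mono_set
      Ioo_subset_Ioc_self)
  · filter_upwards [ae_restrict_mem measurableSet_Ioo] with s hs
    exact Real.rpow_nonneg (sub_nonneg.2 hs.1.le) _

theorem lintegral_Ioo_le_rpow_mul_lintegral_weight {a b σ : ℝ} (hab : a < b) (hσ : 0 < σ)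
    (g : ℝ → ℝ≥0∞) :
    ∫⁻ s in Ioo a b, g s ≤ ENNReal.ofReal ((b - a) ^ σ) *
      ∫⁻ s in Ioo a b, g s * ENNReal.ofReal ((s - a) ^ (-σ)) := by
  rw [← lintegral_const_mul' _ _ ofReal_ne_top]
  refine setLIntegral_mono' measurableSet_Ioo fun s hs => ?_
  have hs0 : 0 < s - a := sub_pos.2 hs.1
  have h1 : 1 ≤ ENNReal.ofReal ((b - a) ^ σ) * ENNReal.ofReal ((s - a) ^ (-σ)) := by
    rw [← ENNReal.ofReal_mul (by have := sub_pos.2 hab; positivity), ENNReal.one_le_ofReal]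
    calc (1 : ℝ) = (s - a) ^ σ * (s - a) ^ (-σ) := by
          rw [← Real.rpow_add hs0]; simp
      _ ≤ _ := by
          gcongr
          exact hs.2.le
  calc g s = g s * 1 := (mul_one _).symm
    _ ≤ g s * (ENNReal.ofReal ((b - a) ^ σ) * ENNReal.ofReal ((s - a) ^ (-σ))) := by gcongr
    _ = _ := by ring

theorem lintegral_Ioo_rpow_le_lintegral_weight {a b q σ : ℝ} (hab : a < b) (hq : 1 < q)
    (hσ : 0 < σ) {g : ℝ → ℝ≥0∞} (hg : Measurable g) :
    (∫⁻ s in Ioo a b, g s) ^ q ≤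
      ENNReal.ofReal (((q - 1) / (q * σ)) ^ (q - 1)) * ENNReal.ofReal ((b - a) ^ (q * σ)) *
        ∫⁻ s in Ioo a b, g s ^ q * ENNReal.ofReal ((s - a) ^ (q - 1 - q * σ)) := by
  have hq0 : 0 < q := by linarith
  have hq1 : 0 < q - 1 := by linarith
  have hba : 0 < b - a := sub_pos.2 hab
  set α := q - 1 - q * σ with hα
  set β := q * σ / (q - 1) with hβ
  have hβ0 : 0 < β := by positivity
  have hconj : q.HolderConjugate (q / (q - 1)) := Real.HolderConjugate.conjExponent hq
  have hsplit : ∫⁻ s in Ioo a b, g s = ∫⁻ s in Ioo a b,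
      ((fun s => g s * ENNReal.ofReal ((s - a) ^ (α / q))) *
        fun s => ENNReal.ofReal ((s - a) ^ (-α / q))) s := by
    refine setLIntegral_congr_fun measurableSet_Ioo fun s hs => ?_
    have hs0 : 0 < s - a := sub_pos.2 hs.1
    simp only [Pi.mul_apply]
    rw [mul_assoc, ← ENNReal.ofReal_mul (by positivity), ← Real.rpow_add hs0]
    simp [neg_div]
  have hfst : ∫⁻ s in Ioo a b, (g s * ENNReal.ofReal ((s - a) ^ (α / q))) ^ q =
      ∫⁻ s in Ioo a b, g s ^ q * ENNReal.ofReal ((s - a) ^ α) := by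
    refine setLIntegral_congr_fun measurableSet_Ioo fun s hs => ?_
    have hs0 : 0 < s - a := sub_pos.2 hs.1
    rw [ENNReal.mul_rpow_of_nonneg _ _ hq0.le, ENNReal.ofReal_rpow_of_nonneg (by positivity) hq0.le,
      ← Real.rpow_mul hs0.le, div_mul_cancel₀ _ hq0.ne']
  have hsnd : ∫⁻ s in Ioo a b, ENNReal.ofReal ((s - a) ^ (-α / q)) ^ (q / (q - 1)) =
      ENNReal.ofReal ((b - a) ^ β / β) := by
    rw [← lintegral_Ioo_ofReal_sub_rpow hab hβ0]
    refine setLIntegral_congr_fun measurableSet_Ioo fun s hs => ?_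
    have hs0 : 0 < s - a := sub_pos.2 hs.1
    rw [ENNReal.ofReal_rpow_of_nonneg (by positivity) (by positivity), ← Real.rpow_mul hs0.le]
    congr 2
    rw [hα, hβ]
    field_simp
    ring
  have hholder := ENNReal.lintegral_mul_le_Lp_mul_Lq (volume.restrict (Ioo a b)) hconj
    (f := fun s => g s * ENNReal.ofReal ((s - a) ^ (α / q)))
    (g := fun s => ENNReal.ofReal ((s - a) ^ (-α / q)))
    (by fun_prop) (by fun_prop)
  rw [← hsplit, hfst, hsnd] at hholder
  refine (ENNReal.rpow_le_rpow hholder hq0.le).trans_eq ?_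
  rw [ENNReal.mul_rpow_of_nonneg _ _ hq0.le, ← ENNReal.rpow_mul, ← ENNReal.rpow_mul,
    one_div_mul_cancel hq0.ne', ENNReal.rpow_one, mul_comm, one_div_div,
    div_mul_cancel₀ _ hq0.ne', ENNReal.ofReal_rpow_of_nonneg (by positivity) hq1.le,
    ← ENNReal.ofReal_mul (by positivity)]
  congr 2
  rw [div_eq_inv_mul, Real.mul_rpow (by positivity) (by positivity), ← Real.rpow_mul hba.le, hβ,
    inv_div, div_mul_cancel₀ _ hq1.ne']

theorem setLIntegral_rpow_lintegral_uIcc_le {a b μ q : ℝ} (hμ : μ ∈ Icc a b)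
    (hq : 0 ≤ q) (g : ℝ → ℝ≥0∞) :
    ∫⁻ r in Ioo a b, (∫⁻ s in Icc (min μ r) (max μ r), g s) ^ q ≤
      ENNReal.ofReal (b - a) * (∫⁻ s in Ioo a b, g s) ^ q := by
  calc ∫⁻ r in Ioo a b, (∫⁻ s in Icc (min μ r) (max μ r), g s) ^ q
      ≤ ∫⁻ _ in Ioo a b, (∫⁻ s in Ioo a b, g s) ^ q := by
        refine setLIntegral_mono' measurableSet_Ioo fun r hr => ?_
        rw [setLIntegral_congr (Ioo_ae_eq_Icc (a := a) (b := b))]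
        gcongr
        · exact le_min hμ.1 hr.1.le
        · exact max_le hμ.2 hr.2.le
    _ = _ := by
        rw [setLIntegral_const, Real.volume_Ioo, mul_comm]

theorem one_dimensional_hardy (q σ : ℝ) (hq : 1 ≤ q) (hσ : 0 < σ) :
    ∃ C : ℝ, 0 < C ∧
      ∀ a b : ℝ, a < b → ∀ μ ∈ Set.Icc a b, ∀ g : ℝ → ℝ≥0∞, Measurable g →
        (∫⁻ r in Set.Ioo a b,
            (∫⁻ s in Set.Icc (min μ r) (max μ r), g s) ^ q) ≤
          ENNReal.ofReal C * ENNReal.ofReal ((b - a) ^ (1 + q * σ)) *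
            ∫⁻ s in Set.Ioo a b, g s ^ q * ENNReal.ofReal ((s - a) ^ (q - 1 - q * σ)) := by
  obtain ⟨C, hC, hbound⟩ : ∃ C : ℝ, 0 < C ∧ ∀ a b : ℝ, a < b → ∀ g : ℝ → ℝ≥0∞, Measurable g →
      (∫⁻ s in Ioo a b, g s) ^ q ≤ ENNReal.ofReal C * ENNReal.ofReal ((b - a) ^ (q * σ)) *
        ∫⁻ s in Ioo a b, g s ^ q * ENNReal.ofReal ((s - a) ^ (q - 1 - q * σ)) := by
    rcases hq.eq_or_lt with rfl | hq
    · refine ⟨1, one_pos, fun a b hab g _ => ?_⟩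
      simpa using lintegral_Ioo_le_rpow_mul_lintegral_weight hab hσ g
    · have hq1 : 0 < q - 1 := sub_pos.2 hq
      exact ⟨((q - 1) / (q * σ)) ^ (q - 1), by positivity,
        fun a b hab g hg => lintegral_Ioo_rpow_le_lintegral_weight hab hq hσ hg⟩
  refine ⟨C, hC, fun a b hab μ hμ g hg => ?_⟩
  have hba : 0 < b - a := sub_pos.2 hab
  refine (setLIntegral_rpow_lintegral_uIcc_le hμ (by linarith) g).trans ?_
  rw [Real.rpow_add hba, Real.rpow_one, ENNReal.ofReal_mul hba.le]
  refine (mul_le_mul_right (hbound a b hab g hg) _).trans_eq ?_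
  ring
end
end
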